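/- The master observable is strongly monotone: for all A,B ∈ 𝒜, P(A) ≤ P(B) (i.e., P(A)P(B) = P(B)P(A) = P(A) as linear maps on 𝒜^*) if and only if A ⊆ B. -/

import Mathlib

/-- `φ : 𝒜 → ZMod 2` is grade-2 additive (a coevent):
`φ(A ∪ B ∪ C) = φ(A∪B) + φ(A∪C) + φ(B∪C) + φ(A) + φ(B) + φ(C)`
for all mutually disjoint `A, B, C`. -/
def Grade2Additive {Ω : Type*} [DecidableEq Ω] (φ : Finset Ω → ZMod 2) : Prop :=
  ∀ A B C : Finset Ω, Disjoint A B → Disjoint A C → Disjoint B C →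
    φ (A ∪ B ∪ C) = φ (A ∪ B) + φ (A ∪ C) + φ (B ∪ C) + φ A + φ B + φ C

/-- The projection `P(ω)` on coevents.  On the basis
`{ω_i^*} ∪ {ω_i^*ω_j^*}` of `𝒜^*` it is given by `P(ω)ω^* = ω^*`,
`P(ω)ω_j^* = ω^*ω_j^*` (`ω_j ≠ ω`), `P(ω)(ω^*ω_j^*) = ω^*ω_j^*` and
`P(ω)(ω_j^*ω_k^*) = 0` for `ω, ω_j, ω_k` distinct; for a coevent
`φ = Σ a_i ω_i^* + Σ b_{ij} ω_i^*ω_j^*` this action is equivalently given by the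
intrinsic formula
`(P(ω)φ)(A) = φ({ω}) + Σ_{j ∈ A, j ≠ ω} (φ({ω,j}) + φ({ω}))` if `ω ∈ A`, else `0`
(noting `a_ω = φ({ω})` and `a_j + b_{ωj} = φ({ω,j}) + φ({ω})`). -/
def Pw {Ω : Type*} [DecidableEq Ω] (ω : Ω) (φ : Finset Ω → ZMod 2) :
    Finset Ω → ZMod 2 := fun A =>
  if ω ∈ A then φ {ω} + ∑ j ∈ A.erase ω, (φ {ω, j} + φ {ω}) else 0

/-- The master observable
`P(A) = Σ_{ω ∈ A} P(ω) + Σ_{ω_i, ω_j ∈ A, i < j} P(ω_i)P(ω_j)`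
(sums of compositions; `P(∅) = 0`). -/
def masterObservable {Ω : Type*} [LinearOrder Ω] (A : Finset Ω)
    (φ : Finset Ω → ZMod 2) : Finset Ω → ZMod 2 :=
  (∑ ω ∈ A, Pw ω φ) +
    ∑ p ∈ (A ×ˢ A).filter (fun p => p.1 < p.2), Pw p.1 (Pw p.2 φ)


namespace Grade2Additive

variable {Ω : Type*} [DecidableEq Ω] {φ ψ : Finset Ω → ZMod 2}

theorem zero : Grade2Additive (0 : Finset Ω → ZMod 2) := by
  intro A B C _ _ _
  simp

theorem add (hφ : Grade2Additive φ) (hψ : Grade2Additive ψ) : Grade2Additive (φ + ψ) := by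
  intro A B C hAB hAC hBC
  simp only [Pi.add_apply, hφ A B C hAB hAC hBC, hψ A B C hAB hAC hBC]
  ring

theorem sum {ι : Type*} {s : Finset ι} {f : ι → Finset Ω → ZMod 2}
    (hf : ∀ i ∈ s, Grade2Additive (f i)) : Grade2Additive (∑ i ∈ s, f i) :=
  Finset.sum_induction f Grade2Additive (fun _ _ => add) zero hf

theorem map_empty (hφ : Grade2Additive φ) : φ ∅ = 0 := by
  have h := hφ ∅ ∅ ∅ (by simp) (by simp) (by simp)
  simp only [Finset.union_idempotent] at h
  rw [h]
  generalize φ ∅ = x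
  revert x
  decide

/-- A coevent is determined by its values on singletons and doubletons. -/
theorem eq_of_singleton_of_pair (hφ : Grade2Additive φ) (hψ : Grade2Additive ψ)
    (h₁ : ∀ i, φ {i} = ψ {i}) (h₂ : ∀ i j, i ≠ j → φ {i, j} = ψ {i, j}) : φ = ψ := by
  funext S
  induction S using Finset.strongInduction with
  | H S ih =>
    rcases S.eq_empty_or_nonempty with rfl | ⟨a, ha⟩
    · rw [hφ.map_empty, hψ.map_empty]
    obtain ⟨T, haT, rfl⟩ : ∃ T, a ∉ T ∧ insert a T = S :=
      ⟨S.erase a, by simp, Finset.insert_erase ha⟩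
    rcases T.eq_empty_or_nonempty with rfl | ⟨b, hb⟩
    · exact h₁ a
    obtain ⟨U, hbU, rfl⟩ : ∃ U, b ∉ U ∧ insert b U = T :=
      ⟨T.erase b, by simp, Finset.insert_erase hb⟩
    rw [Finset.mem_insert, not_or] at haT
    obtain ⟨hab, haU⟩ := haT
    rcases U.eq_empty_or_nonempty with rfl | ⟨c, hc⟩
    · exact h₂ a b hab
    have key : insert a (insert b U) = {a} ∪ {b} ∪ U := by ext; simp
    have hab' : Disjoint ({a} : Finset Ω) {b} := by simpa using hab
    have haU' : Disjoint ({a} : Finset Ω) U := by simpa using haU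
    have hbU' : Disjoint ({b} : Finset Ω) U := by simpa using hbU
    have hsub : ∀ V, V ⊆ {a} ∪ {b} ∪ U → ∀ x ∈ {a} ∪ {b} ∪ U, x ∉ V → φ V = ψ V := by
      intro V hV x hx hxV
      refine ih V ?_
      rw [key]
      exact (Finset.ssubset_iff_of_subset hV).2 ⟨x, hx, hxV⟩
    rw [key, hφ _ _ _ hab' haU' hbU', hψ _ _ _ hab' haU' hbU',
      hsub ({a} ∪ {b}) (by grind) c (by grind) (by grind),
      hsub ({a} ∪ U) (by grind) b (by grind) (by grind),
      hsub ({b} ∪ U) (by grind) a (by grind) (by grind),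
      hsub {a} (by grind) b (by grind) (by grind),
      hsub {b} (by grind) a (by grind) (by grind),
      hsub U (by grind) a (by grind) (by grind)]

/-- The product of a containment map and an affine function of events is a coevent. -/
theorem ite_mem_add_sum (ω : Ω) (c : ZMod 2) (g : Ω → ZMod 2) :
    Grade2Additive fun A => if ω ∈ A then c + ∑ j ∈ A, g j else 0 := by
  intro A B C hAB hAC hBC
  have hABC : Disjoint (A ∪ B) C := Finset.disjoint_union_left.2 ⟨hAC, hBC⟩
  simp only [Finset.sum_union hABC, Finset.sum_union hAB, Finset.sum_union hAC,
    Finset.sum_union hBC, Finset.mem_union]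
  generalize ∑ j ∈ A, g j = x
  generalize ∑ j ∈ B, g j = y
  generalize ∑ j ∈ C, g j = z
  by_cases hA : ω ∈ A
  · simp only [hA, Finset.disjoint_left.1 hAB hA, Finset.disjoint_left.1 hAC hA, or_false,
      if_true, if_false]
    revert c x y z
    decide
  by_cases hB : ω ∈ B
  · simp only [hA, hB, Finset.disjoint_left.1 hBC hB, or_true, or_false, if_true, if_false]
    revert c x y z
    decide
  by_cases hC : ω ∈ C
  · simp only [hA, hB, hC, or_true, or_false, if_true, if_false]
    revert c x y z
    decide
  · simp [hA, hB, hC]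

theorem ite_mem (ω : Ω) :
    Grade2Additive fun A : Finset Ω => if ω ∈ A then (1 : ZMod 2) else 0 := by
  simpa using ite_mem_add_sum ω 1 0

end Grade2Additive

section Pw

variable {Ω : Type*} [DecidableEq Ω]

theorem grade2Additive_Pw (ω : Ω) (φ : Finset Ω → ZMod 2) : Grade2Additive (Pw ω φ) := by
  convert Grade2Additive.ite_mem_add_sum ω
    (φ {ω} - (φ {ω, ω} + φ {ω})) (fun j => φ {ω, j} + φ {ω}) using 1
  funext A
  unfold Pw
  split_ifs with h
  · rw [← Finset.add_sum_erase A _ h]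
    ring
  · rfl

theorem Pw_singleton (ω i : Ω) (φ : Finset Ω → ZMod 2) :
    Pw ω φ {i} = if ω ∈ ({i} : Finset Ω) then φ {i} else 0 := by
  unfold Pw
  split_ifs with h
  · obtain rfl := Finset.mem_singleton.1 h
    simp
  · rfl

theorem Pw_pair (ω : Ω) {i j : Ω} (hij : i ≠ j) (φ : Finset Ω → ZMod 2) :
    Pw ω φ {i, j} = if ω ∈ ({i, j} : Finset Ω) then φ {i, j} else 0 := by
  have cancel : ∀ x y : ZMod 2, x + (y + x) = y := by decide
  unfold Pw
  split_ifs with h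
  · rcases Finset.mem_insert.1 h with rfl | h
    · rw [Finset.erase_insert (by simpa using hij), Finset.sum_singleton, cancel]
    · obtain rfl := Finset.mem_singleton.1 h
      rw [Finset.pair_comm, Finset.erase_insert (by simpa using hij.symm),
        Finset.sum_singleton, cancel]
  · rfl

theorem Pw_congr {ω : Ω} {φ ψ : Finset Ω → ZMod 2} (h₁ : φ {ω} = ψ {ω})
    (h₂ : ∀ j, ω ≠ j → φ {ω, j} = ψ {ω, j}) : Pw ω φ = Pw ω ψ := by
  funext S
  unfold Pw
  rw [h₁, Finset.sum_congr rfl fun j hj => by rw [h₂ j (Finset.ne_of_mem_erase hj).symm]]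

end Pw

section masterObservable

variable {Ω : Type*} [LinearOrder Ω]

theorem grade2Additive_masterObservable (A : Finset Ω) (φ : Finset Ω → ZMod 2) :
    Grade2Additive (masterObservable A φ) :=
  .add (.sum fun _ _ => grade2Additive_Pw _ _) (.sum fun _ _ => grade2Additive_Pw _ _)

theorem masterObservable_singleton (A : Finset Ω) (i : Ω) (φ : Finset Ω → ZMod 2) :
    masterObservable A φ {i} = if i ∈ A then φ {i} else 0 := by
  have hpair : ∑ p ∈ (A ×ˢ A).filter (fun p => p.1 < p.2), Pw p.1 (Pw p.2 φ) {i} = 0 := by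
    refine Finset.sum_eq_zero fun p hp => ?_
    have hlt := (Finset.mem_filter.1 hp).2
    simp only [Pw_singleton, Finset.mem_singleton]
    grind
  simp only [masterObservable, Pi.add_apply, Finset.sum_apply, hpair, add_zero]
  simp [Pw_singleton]

theorem masterObservable_pair (A : Finset Ω) {i j : Ω} (hij : i ≠ j)
    (φ : Finset Ω → ZMod 2) :
    masterObservable A φ {i, j} = if i ∈ A ∨ j ∈ A then φ {i, j} else 0 := by
  wlog hlt : i < j generalizing i j
  · simpa only [Finset.pair_comm, or_comm] using
      this hij.symm (hij.symm.lt_of_le (not_lt.1 hlt))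
  have hsingle : ∑ ω ∈ A, Pw ω φ {i, j} =
      (if i ∈ A then φ {i, j} else 0) + if j ∈ A then φ {i, j} else 0 := by
    have (ω : Ω) : Pw ω φ {i, j} =
        (if ω = i then φ {i, j} else 0) + if ω = j then φ {i, j} else 0 := by
      rw [Pw_pair ω hij]
      simp only [Finset.mem_insert, Finset.mem_singleton]
      grind
    simp [this, Finset.sum_add_distrib]
  have hpair : ∑ p ∈ (A ×ˢ A).filter (fun p => p.1 < p.2), Pw p.1 (Pw p.2 φ) {i, j} =
      if i ∈ A ∧ j ∈ A then φ {i, j} else 0 := by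
    have : ∀ p ∈ (A ×ˢ A).filter (fun p => p.1 < p.2), Pw p.1 (Pw p.2 φ) {i, j} =
        if p = (i, j) then φ {i, j} else 0 := by
      rintro ⟨a, b⟩ hp
      have hab : a < b := (Finset.mem_filter.1 hp).2
      simp only [Pw_pair _ hij, Finset.mem_insert, Finset.mem_singleton, Prod.mk.injEq]
      grind
    rw [Finset.sum_congr rfl this]
    simp [hlt]
  simp only [masterObservable, Pi.add_apply, Finset.sum_apply, hsingle, hpair]
  generalize φ {i, j} = x
  by_cases hi : i ∈ A <;> by_cases hj : j ∈ A <;> simp only [hi, hj] <;> revert x <;> decide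

theorem masterObservable_congr {A : Finset Ω} {φ ψ : Finset Ω → ZMod 2}
    (h₁ : ∀ i ∈ A, φ {i} = ψ {i}) (h₂ : ∀ i ∈ A, ∀ j, i ≠ j → φ {i, j} = ψ {i, j}) :
    masterObservable A φ = masterObservable A ψ := by
  have hPw : ∀ ω ∈ A, Pw ω φ = Pw ω ψ := fun ω hω => Pw_congr (h₁ ω hω) (h₂ ω hω)
  unfold masterObservable
  congr 1
  · exact Finset.sum_congr rfl hPw
  · refine Finset.sum_congr rfl fun p hp => ?_
    rw [hPw p.2 (Finset.mem_product.1 (Finset.mem_filter.1 hp).1).2]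

end masterObservable

/-- The master observable is strongly monotone: as linear maps on the space `𝒜^*`
of coevents, `P(A) ≤ P(B)` (i.e. `P(A)P(B) = P(B)P(A) = P(A)`) iff `A ⊆ B`. -/
theorem statement_18 {Ω : Type*} [Fintype Ω] [LinearOrder Ω] (A B : Finset Ω) :
    (∀ φ : Finset Ω → ZMod 2, Grade2Additive φ →
      masterObservable A (masterObservable B φ) = masterObservable A φ ∧
      masterObservable B (masterObservable A φ) = masterObservable A φ) ↔
    A ⊆ B := by
  constructor
  · intro h ω hωA
    by_contra hωB
    have key := congrFun (h _ (Grade2Additive.ite_mem ω)).2 {ω}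
    simp [masterObservable_singleton, hωA, hωB] at key
  · intro hAB φ _
    constructor
    · refine masterObservable_congr (fun i hi => ?_) fun i hi j hij => ?_
      · rw [masterObservable_singleton, if_pos (hAB hi)]
      · rw [masterObservable_pair B hij, if_pos (Or.inl (hAB hi))]
    · refine (grade2Additive_masterObservable _ _).eq_of_singleton_of_pair
        (grade2Additive_masterObservable _ _) (fun i => ?_) fun i j hij => ?_
      · simp only [masterObservable_singleton]
        grind
      · simp only [masterObservable_pair _ hij]
        grind
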